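/- Let G be a graph in 𝒢₀. Then every 3-cutset of G is a stable set; that is, if deleting three vertices disconnects G, then no two of those three vertices are adjacent. -/

import Mathlib

open SimpleGraph

/-- A *hole* of length `n` in `G`: an induced cycle of length `n ≥ 4`. -/
def SimpleGraph.HasHole {V : Type*} (G : SimpleGraph V) (n : ℕ) : Prop :=
  4 ≤ n ∧ ∃ (v : V) (w : G.Walk v v), w.IsCycle ∧ w.toSubgraph.IsInduced ∧ w.length = n

/-- `G ∈ 𝒢_ℓ`: `G` has girth `2ℓ+1` and no odd hole of length at least `2ℓ+3`. -/
def SimpleGraph.MemGFamily {V : Type*} (G : SimpleGraph V) (l : ℕ) : Prop :=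
  G.egirth = (2 * l + 1 : ℕ) ∧ ∀ n : ℕ, Odd n → 2 * l + 3 ≤ n → ¬ G.HasHole n

/-- `G ∈ 𝒢₀`: `G ∈ 𝒢₂`, `χ(G) = 4`, and every proper subgraph of `G` is 3-colorable. -/
def SimpleGraph.MemG0 {V : Type*} (G : SimpleGraph V) : Prop :=
  G.MemGFamily 2 ∧ G.chromaticNumber = 4 ∧
    ∀ H : G.Subgraph, H ≠ ⊤ → H.coe.Colorable 3

/-- `X` is a cutset of `G`: deleting the vertices of `X` disconnects `G`. -/
def SimpleGraph.IsCutset {V : Type*} (G : SimpleGraph V) (X : Set V) : Prop :=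
  ¬ (G.induce (Xᶜ : Set V)).Connected

/-- `G` is 3-connected: more than 3 vertices, and deleting any at most 2 vertices
leaves a connected graph. -/
def SimpleGraph.ThreeConnected {V : Type*} [Fintype V] (G : SimpleGraph V) : Prop :=
  3 < Fintype.card V ∧ ∀ X : Set V, X.ncard ≤ 2 → (G.induce (Xᶜ : Set V)).Connected


namespace PG
variable {V : Type*} {G : SimpleGraph V}

/-- A chordless path of length `n` from `u` to `v` inside the vertex set `S`. -/
def CP (G : SimpleGraph V) (S : Set V) (u v : V) (n : ℕ) : Prop :=
  ∃ P : G.Walk u v, P.IsPath ∧ P.toSubgraph.IsInduced ∧ (∀ x ∈ P.support, x ∈ S) ∧ P.length = n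

/-- `u` and `v` are joined by a walk inside `S`. -/
def RC (G : SimpleGraph V) (S : Set V) (u v : V) : Prop :=
  ∃ P : G.Walk u v, ∀ x ∈ P.support, x ∈ S

lemma CP.mono {S T : Set V} {u v : V} {n : ℕ} (h : CP G S u v n) (hST : S ⊆ T) : CP G T u v n := by
  obtain ⟨P, h1, h2, h3, h4⟩ := h
  exact ⟨P, h1, h2, fun x hx => hST (h3 x hx), h4⟩

lemma CP.rev {S : Set V} {u v : V} {n : ℕ} (h : CP G S u v n) : CP G S v u n := by
  obtain ⟨P, h1, h2, h3, h4⟩ := h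
  exact ⟨P.reverse, h1.reverse, by simpa using h2, fun x hx => h3 x (by simpa using hx), by simpa⟩

lemma CP.left_mem {S : Set V} {u v : V} {n : ℕ} (h : CP G S u v n) : u ∈ S := by
  obtain ⟨P, h1, h2, h3, h4⟩ := h
  exact h3 u (by simp)

lemma CP.right_mem {S : Set V} {u v : V} {n : ℕ} (h : CP G S u v n) : v ∈ S := h.rev.left_mem

lemma RC.refl {S : Set V} {u : V} (h : u ∈ S) : RC G S u u := ⟨.nil, by simpa using h⟩

lemma RC.symm {S : Set V} {u v : V} (h : RC G S u v) : RC G S v u := by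
  obtain ⟨P, h1⟩ := h
  exact ⟨P.reverse, by simpa using h1⟩

lemma RC.right_mem {S : Set V} {u v : V} (h : RC G S u v) : v ∈ S := by
  obtain ⟨P, h1⟩ := h
  exact h1 v (by simp)

lemma RC.step {S : Set V} {u v w : V} (h : RC G S u v) (hw : G.Adj v w) (hS : w ∈ S) :
    RC G S u w := by
  obtain ⟨P, h1⟩ := h
  refine ⟨P.concat hw, fun x hx => ?_⟩
  rw [Walk.support_concat] at hx
  simp at hx
  rcases hx with hx | rfl
  · exact h1 x hx
  · exact hS

/-- Walks in `S` can be restricted to the component. -/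
lemma RC.comp {S : Set V} {u v : V} (h : RC G S u v) : RC G {x | RC G S u x} u v := by
  classical
  obtain ⟨P, h1⟩ := h
  refine ⟨P, fun x hx => ⟨P.takeUntil x hx, fun y hy => h1 y ?_⟩⟩
  exact P.support_takeUntil_subset_support hx hy

lemma RC.mono {S T : Set V} {u v : V} (h : RC G S u v) (hST : S ⊆ T) : RC G T u v := by
  obtain ⟨P, h1⟩ := h
  exact ⟨P, fun x hx => hST (h1 x hx)⟩

lemma RC.cp {S : Set V} {u v : V} (h : RC G S u v) : ∃ n, CP G S u v n := by
  classical
  have hex : ∃ n, ∃ P : G.Walk u v, (∀ x ∈ P.support, x ∈ S) ∧ P.length = n := by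
    obtain ⟨P, h1⟩ := h
    exact ⟨_, P, h1, rfl⟩
  obtain ⟨P, hP, hl⟩ := Nat.find_spec hex
  have hmin : ∀ Q : G.Walk u v, (∀ x ∈ Q.support, x ∈ S) → P.length ≤ Q.length := by
    intro Q hQ
    rw [hl]
    exact Nat.find_min' hex ⟨Q, hQ, rfl⟩
  obtain ⟨B, hBp, hBs, hBl⟩ : ∃ B : G.Walk u v, B.IsPath ∧ (∀ x ∈ B.support, x ∈ S) ∧
      B.length ≤ P.length :=
    ⟨P.bypass, P.bypass_isPath, fun x hx => hP x (P.support_bypass_subset_support hx),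
      P.length_bypass_le_length⟩
  have key : ∀ i j, i < j → j ≤ B.length → G.Adj (B.getVert i) (B.getVert j) → j = i + 1 := by
    intro i j hij hj hadj
    by_contra hne
    have hQ := hmin ((B.take i).append (Walk.cons hadj (B.drop j))) (by
      intro x hx
      rw [Walk.mem_support_append_iff] at hx
      rcases hx with hx | hx
      · rw [Walk.support_take] at hx
        exact hBs x (List.mem_of_mem_take hx)
      · rw [Walk.support_cons, List.mem_cons] at hx
        rcases hx with rfl | hx
        · exact hBs _ (B.getVert_mem_support i)
        · rw [Walk.drop_support_eq_support_drop_min] at hx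
          exact hBs x (List.mem_of_mem_drop hx))
    rw [Walk.length_append, Walk.length_cons, Walk.take_length, Walk.drop_length] at hQ
    omega
  refine ⟨B.length, B, hBp, ?_, hBs, rfl⟩
  intro x hx y hy hxy
  rw [Walk.mem_verts_toSubgraph, Walk.mem_support_iff_exists_getVert] at hx hy
  obtain ⟨i, rfl, hi⟩ := hx
  obtain ⟨j, rfl, hj⟩ := hy
  rcases lt_trichotomy i j with h | h | h
  · have := key i j h hj hxy
    subst this
    exact B.toSubgraph_adj_getVert (by omega)
  · subst h; exact absurd hxy (G.irrefl)
  · have := key j i h hi hxy.symm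
    subst this
    exact (B.toSubgraph_adj_getVert (by omega)).symm

lemma glue {S T : Set V} {u v : V} {n m : ℕ} (h : CP G S u v n) (h' : CP G T u v m)
    (huv : u ≠ v) (hadj : ¬ G.Adj u v)
    (hST : ∀ x ∈ S, ∀ y ∈ T, x = y ∨ G.Adj x y → x = u ∨ x = v ∨ y = u ∨ y = v) :
    G.HasHole (n + m) := by
  obtain ⟨P, p1, p2, p3, rfl⟩ := h
  obtain ⟨Q, q1, q2, q3, rfl⟩ := h'
  have len : ∀ R : G.Walk u v, 2 ≤ R.length := by
    intro R
    rcases R with _ | ⟨h, R⟩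
    · exact absurd rfl huv
    · rcases R with _ | ⟨h, R⟩
      · exact absurd h hadj
      · simp
  have hP := len P
  have hQ := len Q
  refine ⟨by omega, u, P.append Q.reverse, ?_, ?_, by simp⟩
  · refine p1.isCycle_append q1.reverse ?_ (Or.inl (by omega))
    intro x hx hx'
    have a1 : x ≠ u := by
      rintro rfl
      have := (Walk.isPath_def _).1 p1
      rw [← Walk.cons_tail_support] at this
      exact (List.nodup_cons.1 this).1 hx
    have a2 : x ≠ v := by
      rintro rfl
      have := (Walk.isPath_def _).1 q1.reverse
      rw [← Walk.cons_tail_support] at this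
      exact (List.nodup_cons.1 this).1 hx'
    have b1 := List.mem_of_mem_tail hx
    have b2 := List.mem_of_mem_tail hx'
    have := hST x (p3 x b1) x (q3 x (by simpa using b2)) (Or.inl rfl)
    tauto
  · intro x hx y hy hxy
    rw [Walk.toSubgraph_append, Walk.toSubgraph_reverse] at *
    rw [Subgraph.verts_sup, Set.mem_union] at hx hy
    rw [Subgraph.sup_adj]
    have aux : ∀ x ∈ P.toSubgraph.verts, ∀ y ∈ Q.toSubgraph.verts, G.Adj x y →
        P.toSubgraph.Adj x y ∨ Q.toSubgraph.Adj x y := by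
      intro x hx y hy hxy
      have := hST x (p3 x (by simpa using hx)) y (q3 y (by simpa using hy)) (Or.inr hxy)
      rcases this with rfl | rfl | rfl | rfl
      · exact Or.inr (q2 (by simp) hy hxy)
      · exact Or.inr (q2 (by simp) hy hxy)
      · exact Or.inl (p2 hx (by simp) hxy)
      · exact Or.inl (p2 hx (by simp) hxy)
    rcases hx with hx | hx <;> rcases hy with hy | hy
    · exact Or.inl (p2 hx hy hxy)
    · exact aux x hx y hy hxy
    · exact (aux y hy x hx hxy.symm).imp (·.symm) (·.symm)
    · exact Or.inr (q2 hx hy hxy)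

lemma CP.ext {S : Set V} {u v w : V} {n : ℕ} (h : CP G S u v n) (hw : G.Adj w u) (hwS : w ∉ S)
    (hS : ∀ x ∈ S, G.Adj w x → x = u) : CP G (insert w S) w v (n + 1) := by
  obtain ⟨P, p1, p2, p3, rfl⟩ := h
  refine ⟨Walk.cons hw P, ?_, ?_, ?_, by simp⟩
  · rw [Walk.cons_isPath_iff]
    exact ⟨p1, fun hx => hwS (p3 _ hx)⟩
  · intro x hx y hy hxy
    simp only [Walk.toSubgraph, Subgraph.verts_sup, Set.mem_union, Walk.mem_verts_toSubgraph,
      subgraphOfAdj_verts, Set.mem_insert_iff, Set.mem_singleton_iff] at hx hy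
    have hx' : x = w ∨ x ∈ P.support := by
      rcases hx with (h | rfl) | h
      · exact Or.inl h
      · exact Or.inr (by simp)
      · exact Or.inr h
    have hy' : y = w ∨ y ∈ P.support := by
      rcases hy with (h | rfl) | h
      · exact Or.inl h
      · exact Or.inr (by simp)
      · exact Or.inr h
    simp only [Walk.toSubgraph, Subgraph.sup_adj]
    rcases hx' with rfl | hx' <;> rcases hy' with rfl | hy'
    · exact absurd hxy G.irrefl
    · have := hS y (p3 y hy') hxy
      subst this
      left; simp
    · have := hS x (p3 x hx') hxy.symm
      subst this
      left; simp
    · right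
      exact p2 (by simpa using hx') (by simpa using hy') hxy
  · intro x hx
    rw [Walk.support_cons, List.mem_cons] at hx
    exact hx.imp id (p3 x)

lemma CP.parity {S : Set V} {u v : V} {n : ℕ} (h : CP G S u v n) {f : V → Fin 3} {p q : Fin 3}
    (hc : ∀ x ∈ S, f x = p ∨ f x = q)
    (hf : ∀ x ∈ S, ∀ y ∈ S, G.Adj x y → f x ≠ f y) : Even n ↔ f u = f v := by
  obtain ⟨P, p1, p2, p3, rfl⟩ := h
  clear p1 p2
  induction P with
  | nil => simp
  | @cons a b c h P ih =>
    have ih := ih (fun x hx => p3 x (by simp [hx]))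
    have h1 := p3 a (by simp)
    have h2 := p3 b (by simp)
    have h3 := p3 c (by simp)
    have h4 := hf _ h1 _ h2 h
    have h5 := hc _ h1
    have h6 := hc _ h2
    have h7 := hc _ h3
    rw [Walk.length_cons, Nat.even_add_one, ih]
    grind

lemma CP.len2 {S : Set V} {u v : V} (h : CP G S u v 2) : ∃ x ∈ S, G.Adj u x ∧ G.Adj x v := by
  obtain ⟨P, p1, p2, p3, h⟩ := h
  rcases P with _ | ⟨h1, P⟩
  · simp at h
  rcases P with _ | ⟨h2, P⟩
  · simp at h
  rcases P with _ | ⟨h3, P⟩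
  · exact ⟨_, p3 _ (by simp), h1, h2⟩
  · simp at h

lemma CP.len3 {S : Set V} {u v : V} (h : CP G S u v 3) : ∃ p ∈ S, ∃ q ∈ S,
    G.Adj u p ∧ G.Adj p q ∧ G.Adj q v ∧ CP G {u, p, q, v} u v 3 := by
  obtain ⟨P, p1, p2, p3, h⟩ := h
  rcases P with _ | ⟨h1, P⟩
  · simp at h
  rcases P with _ | ⟨h2, P⟩
  · simp at h
  rcases P with _ | ⟨h3, P⟩
  · simp at h
  rcases P with _ | ⟨h4, P⟩
  · exact ⟨_, p3 _ (by simp), _, p3 _ (by simp), h1, h2, h3, _, p1, p2, by simp, rfl⟩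
  · simp at h

lemma CP.two_le {S : Set V} {u v : V} {n : ℕ} (h : CP G S u v n) (huv : u ≠ v)
    (hadj : ¬ G.Adj u v) : 2 ≤ n := by
  obtain ⟨R, -, -, -, rfl⟩ := h
  rcases R with _ | ⟨h, R⟩
  · exact absurd rfl huv
  · rcases R with _ | ⟨h, R⟩
    · exact absurd h hadj
    · simp

lemma reroute {S : Set V} {a b c : V} {n : ℕ} (h : CP G S a c n) (hab : G.Adj a b) (hac : a ≠ c)
    (nac : ¬ G.Adj a c) (hbS : b ∉ S) (no3 : ∀ x, G.Adj a x → G.Adj b x → False) :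
    (∃ S', S' ⊆ S ∧ (∀ x ∈ S', G.Adj b x → x = a) ∧ CP G S' a c n) ∨
    (∃ S' m, S' ⊆ insert b S ∧ a ∉ S' ∧ (∀ y ∈ S', G.Adj a y → y = b) ∧ CP G S' b c m) := by
  obtain ⟨P, p1, p2, p3, rfl⟩ := h
  by_cases hz : ∀ x ∈ P.support, G.Adj b x → x = a
  · exact Or.inl ⟨{x | x ∈ P.support}, p3, hz, P, p1, p2, fun x hx => hx, rfl⟩
  right
  push Not at hz
  obtain ⟨z, hz, hbz, hza⟩ := hz
  rcases P with _ | ⟨h1, P⟩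
  · exact absurd rfl hac
  rcases P with _ | ⟨h2, P⟩
  · exact absurd h1 nac
  rename_i r1 r2
  have hzP : z ∈ P.support := by
    simp at hz
    rcases hz with rfl | rfl | hz
    · exact absurd rfl hza
    · exact (no3 _ h1 hbz).elim
    · exact hz
  simp only [Walk.cons_isPath_iff, Walk.support_cons, List.mem_cons, not_or] at p1
  obtain ⟨⟨pp, hr1⟩, har1, haP⟩ := p1
  have hbP : ∀ y ∈ P.support, G.Adj a y → False := by
    intro y hy hay
    have := p2 (v := a) (w := y) (by simp) (by simp [hy]) hay
    simp [Walk.toSubgraph] at this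
    have hne : a ≠ y := by rintro rfl; exact haP hy
    have hne' : y ≠ r1 := by rintro rfl; exact hr1 hy
    rcases this with h | h | h
    · grind
    · grind
    · exact haP (by simpa using h.fst_mem)
  have hrc : RC G (insert b {x | x ∈ P.support}) c z := by
    classical
    refine RC.symm ⟨P.dropUntil z hzP, fun x hx => ?_⟩
    exact Or.inr (P.support_dropUntil_subset_support hzP hx)
  obtain ⟨m, hm⟩ := (hrc.step hbz.symm (by simp)).symm.cp
  refine ⟨_, m, ?_, ?_, ?_, hm⟩
  · rintro x (rfl | hx)
    · simp
    · right; exact p3 x (by simp at hx; simp [hx])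
  · rintro (rfl | hx)
    · exact G.irrefl hab
    · exact haP hx
  · rintro y (rfl | hy) hay
    · rfl
    · exact (hbP y hy hay).elim


/-- `f` is a proper colouring of the part of `G` on `A`. -/
def Col (G : SimpleGraph V) (A : Set V) (f : V → Fin 3) : Prop :=
  ∀ x ∈ A, ∀ y ∈ A, G.Adj x y → f x ≠ f y

/-- some colouring of `A` gives `c` and `a` the same colour -/
def TE (G : SimpleGraph V) (A : Set V) (a c : V) : Prop :=
  ∃ f, Col G A f ∧ f c = f a

/-- some colouring of `A` gives `c` a colour different from those of `a`, `b` -/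
def TD (G : SimpleGraph V) (A : Set V) (a b c : V) : Prop :=
  ∃ f, Col G A f ∧ f c ≠ f a ∧ f c ≠ f b

lemma recolor {A K : Set V} {f : V → Fin 3} {p q : Fin 3} (hf : Col G A f)
    (hK : ∀ x ∈ K, x ∈ A ∧ (f x = p ∨ f x = q))
    (hcl : ∀ x ∈ K, ∀ y ∈ A, G.Adj x y → (f y = p ∨ f y = q) → y ∈ K) :
    ∃ g, Col G A g ∧ (∀ x ∈ K, g x = Equiv.swap p q (f x)) ∧ ∀ x, x ∉ K → g x = f x := by
  classical
  refine ⟨fun x => if x ∈ K then Equiv.swap p q (f x) else f x, ?_, ?_, ?_⟩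
  · have aux : ∀ x ∈ A, ∀ y ∈ A, G.Adj x y → x ∈ K → y ∉ K → Equiv.swap p q (f x) ≠ f y := by
      intro x hx y hy hxy hxK hyK h
      have h1 := hcl x hxK y hy hxy
      have h2 := (hK x hxK).2
      rcases h2 with h2 | h2
      · rw [h2, Equiv.swap_apply_left] at h
        exact hyK (h1 (Or.inr h.symm))
      · rw [h2, Equiv.swap_apply_right] at h
        exact hyK (h1 (Or.inl h.symm))
    intro x hx y hy hxy
    have := hf x hx y hy hxy
    by_cases h1 : x ∈ K <;> by_cases h2 : y ∈ K <;> simp only [h1, h2, if_true, if_false]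
    · simpa using this
    · exact aux x hx y hy hxy h1 h2
    · exact (aux y hy x hx hxy.symm h2 h1).symm
    · exact this
  · intro x hx; simp [hx]
  · intro x hx; simp [hx]

lemma kempe1 {A : Set V} {f : V → Fin 3} {p q : Fin 3} (hf : Col G A f) {c t : V} (hc : c ∈ A)
    (hcp : f c = p ∨ f c = q) :
    (∃ n, CP G {x | x ∈ A ∧ (f x = p ∨ f x = q)} t c n) ∨
    ∃ g, Col G A g ∧ g c = Equiv.swap p q (f c) ∧ g t = f t ∧
      ∀ x, f x ≠ p → f x ≠ q → g x = f x := by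
  by_cases h : RC G {x | x ∈ A ∧ (f x = p ∨ f x = q)} c t
  · exact Or.inl h.symm.cp
  right
  obtain ⟨g, g1, g2, g3⟩ := recolor (G := G) (A := A) (f := f) (p := p) (q := q)
    (K := {x | RC G {x | x ∈ A ∧ (f x = p ∨ f x = q)} c x}) hf
    (fun x hx => by have h := RC.right_mem hx; exact h) (fun x hx y hy hxy hq => RC.step hx hxy ⟨hy, hq⟩)
  refine ⟨g, g1, g2 c (RC.refl ⟨hc, hcp⟩), g3 t h, fun x h1 h2 => g3 x fun h => ?_⟩
  have := (RC.right_mem h).2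
  tauto

lemma kempe2 {A : Set V} {f : V → Fin 3} {p q : Fin 3} (hf : Col G A f) {c s t : V} (hc : c ∈ A)
    (hcp : f c = p ∨ f c = q) (hs : s ∈ A) (hsp : f s = p ∨ f s = q) (hst : s ≠ t)
    (hct : c ≠ t) (ht : t ∈ A) (htp : f t = p ∨ f t = q) :
    (∃ n, CP G {x | (x ∈ A ∧ (f x = p ∨ f x = q)) ∧ x ≠ t} s c n) ∨
    (∃ S n, CP G S t c n ∧ (∀ x ∈ S, x ∈ A ∧ (f x = p ∨ f x = q)) ∧ s ∉ S ∧
      (∀ x ∈ S, G.Adj s x → x = t)) ∨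
    ∃ g, Col G A g ∧ g c = Equiv.swap p q (f c) ∧ g s = f s ∧ g t = f t := by
  set S := {x | (x ∈ A ∧ (f x = p ∨ f x = q)) ∧ x ≠ t} with hS
  by_cases h : RC G S c s
  · exact Or.inl h.symm.cp
  right
  by_cases h' : ∃ k, RC G S c k ∧ G.Adj k t
  · left
    obtain ⟨k, hk, hkt⟩ := h'
    obtain ⟨n, hn⟩ := ((hk.comp.mono (Set.subset_insert t _)).step hkt (by simp)).symm.cp
    refine ⟨_, n, hn, ?_, ?_, ?_⟩
    · rintro x (rfl | hx)
      · exact ⟨ht, htp⟩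
      · exact (RC.right_mem hx).1
    · rintro (rfl | hx)
      · exact hst rfl
      · exact h hx
    · rintro x (rfl | hx) hsx
      · rfl
      · exact (h (RC.step hx hsx.symm ⟨⟨hs, hsp⟩, hst⟩)).elim
  · right
    obtain ⟨g, g1, g2, g3⟩ := recolor (G := G) (A := A) (f := f) (p := p) (q := q)
      (K := {x | RC G S c x}) hf
      (fun x hx => (RC.right_mem hx).1) (fun x hx y hy hxy hq => by
        refine RC.step hx hxy ⟨⟨hy, hq⟩, ?_⟩
        rintro rfl
        exact h' ⟨x, hx, hxy⟩)
    exact ⟨g, g1, g2 c (RC.refl ⟨⟨hc, hcp⟩, hct⟩), g3 s h,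
      g3 t fun h => (RC.right_mem h).2 rfl⟩

lemma third : ∀ p q : Fin 3, p ≠ q → ∃ r : Fin 3, r ≠ p ∧ r ≠ q := by decide

lemma evenS {A S : Set V} {f : V → Fin 3} {p q : Fin 3} (hf : Col G A f) {u v : V} {n : ℕ}
    (hS : ∀ x ∈ S, x ∈ A ∧ (f x = p ∨ f x = q)) (h : CP G S u v n) : Even n ↔ f u = f v :=
  h.parity (fun x hx => (hS x hx).2) (fun x hx y hy => hf x (hS x hx).1 y (hS y hy).1)

/-- even path -/
lemma F1 {A : Set V} {a b c : V} {f : V → Fin 3} (ha : a ∈ A) (hb : b ∈ A) (hc : c ∈ A)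
    (hab : G.Adj a b) (hf : Col G A f) (hca : f c = f a) (nd : ¬ TD G A a b c) :
    ∃ n S, Even n ∧ S ⊆ A ∧ b ∉ S ∧ (∀ x ∈ S, f x ≠ f b) ∧ CP G S a c n := by
  have hfab := hf a ha b hb hab
  obtain ⟨r, r1, r2⟩ := third _ _ hfab
  rcases kempe1 (p := f a) (q := r) (t := a) hf hc (Or.inl hca) with ⟨n, hn⟩ | ⟨g, g1, g2, g3, g4⟩
  · have hS : ∀ x ∈ {x | x ∈ A ∧ (f x = f a ∨ f x = r)}, f x ≠ f b := by
      rintro x ⟨-, h | h⟩ <;> rw [h] <;> assumption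
    exact ⟨n, _, (evenS hf (fun x hx => hx) hn).2 hca.symm, fun x hx => hx.1,
      fun h => hS b h rfl, hS, hn⟩
  · refine (nd ⟨g, g1, ?_, ?_⟩).elim
    · rw [g2, g3, hca, Equiv.swap_apply_left]; exact r1
    · rw [g2, g4 b hfab.symm r2.symm, hca, Equiv.swap_apply_left]; exact r2

/-- odd path -/
lemma F2 {A : Set V} {a b c : V} {f : V → Fin 3} (hb : b ∈ A) (ha : a ∈ A) (hc : c ∈ A)
    (hab : G.Adj a b) (hf : Col G A f) (hca : f c ≠ f a) (hcb : f c ≠ f b) (ne : ¬ TE G A a c) :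
    ∃ n S, Odd n ∧ S ⊆ A ∧ b ∉ S ∧ (∀ x ∈ S, f x ≠ f b) ∧ CP G S a c n := by
  have hfab := hf a ha b hb hab
  rcases kempe1 (p := f a) (q := f c) (t := a) hf hc (Or.inr rfl) with
    ⟨n, hn⟩ | ⟨g, g1, g2, g3, g4⟩
  · have hS : ∀ x ∈ {x | x ∈ A ∧ (f x = f a ∨ f x = f c)}, f x ≠ f b := by
      rintro x ⟨-, h | h⟩ <;> rw [h] <;> assumption
    exact ⟨n, _, by
      rw [← Nat.not_even_iff_odd, evenS hf (fun x hx => hx) hn]; exact hca.symm,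
      fun x hx => hx.1, fun h => hS b h rfl, hS, hn⟩
  · refine (ne ⟨g, g1, ?_⟩).elim
    rw [g2, g3, Equiv.swap_apply_right]

/-- The combined path lemma, first version. -/
lemma F3i {A : Set V} {a b c : V} (ha : a ∈ A) (hb : b ∈ A) (hc : c ∈ A) (hab : G.Adj a b)
    (hac : a ≠ c) (hbc : b ≠ c) (no4 : ∀ x y, x ≠ y → G.Adj a x → G.Adj x c → G.Adj a y →
      G.Adj y c → False)
    (te : TE G A a c) (nd : ¬ TD G A a b c) (ne : ¬ TE G A b c) :
    ∃ n S, Even n ∧ S ⊆ A ∧ b ∉ S ∧ CP G S a c n ∧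
    ((∃ m T, Odd m ∧ T ⊆ A ∧ a ∉ T ∧ CP G T b c m) ∨
     (∃ m T, Even m ∧ T ⊆ A ∧ b ∉ T ∧ (∀ x ∈ T, G.Adj b x → x = a) ∧ CP G T a c m ∧
      ¬ (n = 2 ∧ m = 2))) := by
  obtain ⟨f, hf, hca⟩ := te
  have hfab := hf a ha b hb hab
  obtain ⟨n, S, h1, h2, h3, h4, h5⟩ := F1 ha hb hc hab hf hca nd
  refine ⟨n, S, h1, h2, h3, h5, ?_⟩
  rcases kempe2 (p := f a) (q := f b) (s := b) (t := a) hf hc (Or.inl hca) hb (Or.inr rfl)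
    hab.ne.symm hac.symm ha (Or.inl rfl) with ⟨m, hm⟩ | ⟨T, m, hm, t1, t2, t3⟩ | ⟨g, g1, g2, g3, g4⟩
  · left
    refine ⟨m, _, ?_, fun x hx => hx.1.1, fun h => h.2 rfl, hm⟩
    rw [← Nat.not_even_iff_odd, evenS hf (fun x hx => hx.1) hm, hca]
    exact hfab.symm
  · right
    refine ⟨m, T, (evenS hf t1 hm).2 hca.symm, fun x hx => (t1 x hx).1, t2, t3, hm, ?_⟩
    rintro ⟨rfl, rfl⟩
    obtain ⟨x, x1, x2, x3⟩ := h5.len2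
    obtain ⟨y, y1, y2, y3⟩ := hm.len2
    refine no4 x y ?_ x2 x3 y2 y3
    rintro rfl
    have z1 := h4 x x1
    have z2 := (t1 x y1).2
    have z3 := hf a ha x (t1 x y1).1 x2
    grind
  · refine (ne ⟨g, g1, ?_⟩).elim
    rw [g2, g3, hca, Equiv.swap_apply_left]

/-- The combined path lemma, second version. -/
lemma F3ii {A : Set V} {a b c : V} (ha : a ∈ A) (hb : b ∈ A) (hc : c ∈ A) (hab : G.Adj a b)
    (hac : a ≠ c) (hbc : b ≠ c) (no4 : ∀ x y, x ≠ y → G.Adj a x → G.Adj x c → G.Adj a y →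
      G.Adj y c → False)
    (te : TE G A a c) (nd : ¬ TD G A a b c) (ne : ¬ TE G A b c) :
    ∃ n S, Even n ∧ S ⊆ A ∧ b ∉ S ∧ CP G S a c n ∧
    ((∃ m T, Odd m ∧ T ⊆ A ∧ a ∉ T ∧ (∀ x ∈ T, G.Adj a x → x = b) ∧ CP G T b c m) ∨
     (∃ m T, Even m ∧ T ⊆ A ∧ b ∉ T ∧ CP G T a c m ∧ ¬ (n = 2 ∧ m = 2))) := by
  obtain ⟨f, hf, hca⟩ := te
  have hfab := hf a ha b hb hab
  obtain ⟨n, S, h1, h2, h3, h4, h5⟩ := F1 ha hb hc hab hf hca nd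
  refine ⟨n, S, h1, h2, h3, h5, ?_⟩
  rcases kempe2 (p := f a) (q := f b) (s := a) (t := b) hf hc (Or.inl hca) ha (Or.inl rfl)
    hab.ne hbc.symm hb (Or.inr rfl) with ⟨m, hm⟩ | ⟨T, m, hm, t1, t2, t3⟩ | ⟨g, g1, g2, g3, g4⟩
  · right
    refine ⟨m, _, (evenS hf (fun x hx => hx.1) hm).2 hca.symm, fun x hx => hx.1.1,
      fun h => h.2 rfl, hm, ?_⟩
    rintro ⟨rfl, rfl⟩
    obtain ⟨x, x1, x2, x3⟩ := h5.len2
    obtain ⟨y, y1, y2, y3⟩ := hm.len2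
    refine no4 x y ?_ x2 x3 y2 y3
    rintro rfl
    have z1 := h4 x x1
    have z2 := y1.1.2
    have z3 := hf a ha x y1.1.1 x2
    grind
  · left
    refine ⟨m, T, ?_, fun x hx => (t1 x hx).1, t2, t3, hm⟩
    rw [← Nat.not_even_iff_odd, evenS hf t1 hm, hca]
    exact hfab.symm
  · refine (ne ⟨g, g1, ?_⟩).elim
    rw [g2, g4, hca, Equiv.swap_apply_left]

/-- The configuration: a graph split along `a, b, c` into `A` and `B`, with `a` adjacent to `b`. -/
structure Cfg (G : SimpleGraph V) (a b c : V) (A B : Set V) : Prop where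
  no3 : ∀ x y z, G.Adj x y → G.Adj y z → G.Adj z x → False
  no4 : ∀ x y z w, x ≠ z → y ≠ w → G.Adj x y → G.Adj y z → G.Adj z w → G.Adj w x → False
  hole : ∀ n, Odd n → G.HasHole n → n = 5
  hab : G.Adj a b
  hac : a ≠ c
  hbc : b ≠ c
  int : ∀ x, x ∈ A → x ∈ B → x = a ∨ x = b ∨ x = c
  aA : a ∈ A
  bA : b ∈ A
  cA : c ∈ A
  aB : a ∈ B
  bB : b ∈ B
  cB : c ∈ B
  sep : ∀ x ∈ A, ∀ y ∈ B, G.Adj x y → x ∈ B ∨ y ∈ A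
  nEa : TE G A a c → TE G B a c → False
  nEb : TE G A b c → TE G B b c → False
  nD : TD G A a b c → TD G B a b c → False
  exA : TE G A a c ∨ TE G A b c ∨ TD G A a b c
  exB : TE G B a c ∨ TE G B b c ∨ TD G B a b c

lemma TD.swap {A : Set V} {a b c : V} (h : TD G A a b c) : TD G A b a c := by
  obtain ⟨f, h1, h2, h3⟩ := h
  exact ⟨f, h1, h3, h2⟩

variable {a b c : V} {A B : Set V}

lemma Cfg.swapAB (C : Cfg G a b c A B) : Cfg G a b c B A :=
  { C with
    int := fun x h1 h2 => C.int x h2 h1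
    aA := C.aB, bA := C.bB, cA := C.cB, aB := C.aA, bB := C.bA, cB := C.cA
    sep := fun x hx y hy h => (C.sep y hy x hx h.symm).symm
    nEa := fun h1 h2 => C.nEa h2 h1
    nEb := fun h1 h2 => C.nEb h2 h1
    nD := fun h1 h2 => C.nD h2 h1
    exA := C.exB, exB := C.exA }

lemma Cfg.swapab (C : Cfg G a b c A B) : Cfg G b a c A B :=
  { C with
    hab := C.hab.symm, hac := C.hbc, hbc := C.hac
    int := fun x h1 h2 => by have := C.int x h1 h2; tauto
    aA := C.bA, bA := C.aA, aB := C.bB, bB := C.aB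
    nEa := C.nEb, nEb := C.nEa
    nD := fun h1 h2 => C.nD h1.swap h2.swap
    exA := by
      rcases C.exA with h | h | h
      exacts [Or.inr (Or.inl h), Or.inl h, Or.inr (Or.inr h.swap)]
    exB := by
      rcases C.exB with h | h | h
      exacts [Or.inr (Or.inl h), Or.inl h, Or.inr (Or.inr h.swap)] }

lemma Cfg.sep3 (C : Cfg G a b c A B) {x y : V} (hx : x ∈ A) (hy : y ∈ B) (h : x = y ∨ G.Adj x y) :
    (x = a ∨ x = b ∨ x = c) ∨ (y = a ∨ y = b ∨ y = c) := by
  rcases h with rfl | h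
  · exact Or.inl (C.int _ hx hy)
  · rcases C.sep x hx y hy h with h | h
    · exact Or.inl (C.int _ hx h)
    · exact Or.inr (C.int _ h hy)

lemma Cfg.no4' (C : Cfg G a b c A B) (u v : V) (huv : u ≠ v) : ∀ x y, x ≠ y → G.Adj u x →
    G.Adj x v → G.Adj u y → G.Adj y v → False :=
  fun x y hxy h1 h2 h3 h4 => C.no4 u x v y huv hxy h1 h2 h4.symm h3.symm

lemma Cfg.glue1 (C : Cfg G a b c A B) (nac : ¬ G.Adj a c) {S T : Set V} {n m : ℕ}
    (h : CP G S a c n) (h' : CP G T a c m) (hS : S ⊆ A) (hT : T ⊆ B) (bS : b ∉ S) (bT : b ∉ T)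
    (hodd : Odd (n + m)) : n + m = 5 := by
  refine C.hole _ hodd (glue h h' C.hac nac ?_)
  intro x hx y hy hxy
  have hx' : x ≠ b := by rintro rfl; exact bS hx
  have hy' : y ≠ b := by rintro rfl; exact bT hy
  have := C.sep3 (hS hx) (hT hy) hxy
  tauto

lemma Cfg.glue2' (C : Cfg G a b c A B) (nac : ¬ G.Adj a c) {S T : Set V} {n m : ℕ}
    (h : CP G S a c n) (h' : CP G T b c m)
    (hST : ∀ x ∈ S, ∀ y ∈ T, x = y ∨ G.Adj x y →
      (x = a ∨ x = b ∨ x = c) ∨ (y = a ∨ y = b ∨ y = c))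
    (bS : b ∉ S) (aT : a ∉ T)
    (nS : ∀ x ∈ S, G.Adj b x → x = a) (nT : ∀ x ∈ T, G.Adj a x → x = b)
    (hodd : Odd (n + (m + 1))) : n + (m + 1) = 5 := by
  refine C.hole _ hodd (glue h (h'.ext C.hab aT nT) C.hac nac ?_)
  rintro x hx y (rfl | hy) hxy
  · tauto
  have hx' : x ≠ b := by rintro rfl; exact bS hx
  have hy' : y ≠ a := by rintro rfl; exact aT hy
  have h1 := hST x hx y hy hxy
  by_cases hyb : y = b
  · subst hyb
    rcases hxy with hxy | hxy
    · exact absurd hxy hx'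
    · exact Or.inl (nS x hx hxy.symm)
  · tauto

lemma Cfg.glue2 (C : Cfg G a b c A B) (nac : ¬ G.Adj a c) {S T : Set V} {n m : ℕ}
    (h : CP G S a c n) (h' : CP G T b c m) (hS : S ⊆ A) (hT : T ⊆ B)
    (bS : b ∉ S) (aT : a ∉ T)
    (nS : ∀ x ∈ S, G.Adj b x → x = a) (nT : ∀ x ∈ T, G.Adj a x → x = b)
    (hodd : Odd (n + (m + 1))) : n + (m + 1) = 5 :=
  C.glue2' nac h h' (fun _ hx _ hy hxy => C.sep3 (hS hx) (hT hy) hxy) bS aT nS nT hodd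

/-- Case A: `c` adjacent to `b`. -/
lemma Cfg.caseA (C : Cfg G a b c A B) (hcb : G.Adj c b) : False := by
  have nac : ¬ G.Adj a c := fun h => C.no3 a c b h hcb C.hab.symm
  have key : ∀ {A B : Set V}, Cfg G a b c A B → TE G A a c → ¬ TD G A a b c → TD G B a b c →
      ¬ TE G B a c → False := by
    intro A B C ⟨f, hf, hca⟩ nd ⟨g, hg, gca, gcb⟩ ne
    obtain ⟨n, S, n1, S1, S2, -, h1⟩ := F1 C.aA C.bA C.cA C.hab hf hca nd
    obtain ⟨m, T, m1, T1, T2, -, h2⟩ := F2 C.bB C.aB C.cB C.hab hg gca gcb ne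
    have h5 := C.glue1 nac h1 h2 S1 T1 S2 T2 (n1.add_odd m1)
    have l1 := h1.two_le C.hac nac
    have l2 := h2.two_le C.hac nac
    have : n = 2 := by
      obtain ⟨k, rfl⟩ := n1
      omega
    subst this
    obtain ⟨x, x1, x2, x3⟩ := h1.len2
    exact C.no4' a c C.hac x b (by rintro rfl; exact S2 x1) x2 x3 C.hab hcb.symm
  have nA : ¬ TE G A b c := fun ⟨f, hf, h⟩ => hf c C.cA b C.bA hcb h
  have nB : ¬ TE G B b c := fun ⟨f, hf, h⟩ => hf c C.cB b C.bB hcb h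
  have e1 := C.exA
  have e2 := C.exB
  have d1 := C.nEa
  have d2 := C.nD
  have k1 := key C
  have k2 := key C.swapAB
  tauto

/-- a chordless path of length 3 has no other neighbours of a vertex attached to its start -/
lemma Cfg.tight (C : Cfg G a b c A B) (nbc : ¬ G.Adj b c) {p q : V} (h1 : G.Adj a p)
    (h2 : G.Adj p q) (hpb : p ≠ b) (hqa : q ≠ a) :
    ∀ x ∈ ({a, p, q, c} : Set V), G.Adj b x → x = a := by
  rintro x (rfl | rfl | rfl | rfl) hx
  · rfl
  · exact (C.no3 _ _ _ h1 hx.symm C.hab.symm).elim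
  · exact (C.no4 a p x b hqa.symm hpb h1 h2 hx.symm C.hab.symm).elim
  · exact absurd hx nbc

lemma Cfg.len3' (C : Cfg G a b c A B) (nac : ¬ G.Adj a c) (nbc : ¬ G.Adj b c) {S : Set V}
    (h : CP G S a c 3) (bS : b ∉ S) :
    ∃ p ∈ S, ∃ q ∈ S, G.Adj a p ∧ G.Adj p q ∧ G.Adj q c ∧ CP G {a, p, q, c} a c 3 ∧
    ({a, p, q, c} : Set V) ⊆ S ∧ (∀ x ∈ ({a, p, q, c} : Set V), G.Adj b x → x = a) := by
  obtain ⟨p, p1, q, q1, h1, h2, h3, h4⟩ := h.len3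
  refine ⟨p, p1, q, q1, h1, h2, h3, h4, ?_, ?_⟩
  · rintro x (rfl | rfl | rfl | rfl)
    exacts [h.left_mem, p1, q1, h.right_mem]
  · exact C.tight nbc h1 h2 (by rintro rfl; exact bS p1) (by rintro rfl; exact nac h3)

/-- Case I. -/
lemma Cfg.caseI (C : Cfg G a b c A B) (nac : ¬ G.Adj a c) (nbc : ¬ G.Adj b c)
    (te : TE G A a c) (nd : ¬ TD G A a b c) (ne : ¬ TE G A b c) (td : TD G B a b c)
    (ne' : ¬ TE G B a c) : False := by
  obtain ⟨g, hg, gca, gcb⟩ := td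
  obtain ⟨m, T, m1, T1, T2, -, h2⟩ := F2 C.bB C.aB C.cB C.hab hg gca gcb ne'
  obtain ⟨n, S, n1, S1, S2, h1, h3⟩ :=
    F3ii C.aA C.bA C.cA C.hab C.hac C.hbc (C.no4' a c C.hac) te nd ne
  have h5 := C.glue1 nac h1 h2 S1 T1 S2 T2 (n1.add_odd m1)
  have l1 := h1.two_le C.hac nac
  have l2 := h2.two_le C.hac nac
  have hn : n = 2 := by
    obtain ⟨k, rfl⟩ := n1
    omega
  have hm : m = 3 := by omega
  subst hm
  rcases h3 with ⟨k, U, k1, U1, U2, U3, h3⟩ | ⟨k, U, k1, U1, U2, h3, h4⟩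
  · obtain ⟨p, p1, q, q1, -, -, -, hP, hsub, hnb⟩ := C.len3' nac nbc h2 T2
    have := C.swapAB.glue2 nac hP h3 (hsub.trans T1) U1 (fun h => T2 (hsub h)) U2 hnb U3
      (by obtain ⟨j, rfl⟩ := k1; exact ⟨j + 2, by ring⟩)
    have := h3.two_le C.hbc nbc
    omega
  · have := C.glue1 nac h3 h2 U1 T1 U2 T2 (k1.add_odd m1)
    exact h4 ⟨hn, by omega⟩

/-- Case II. -/
lemma Cfg.caseII (C : Cfg G a b c A B) (nac : ¬ G.Adj a c) (nbc : ¬ G.Adj b c)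
    (td : TD G A a b c) (na : ¬ TE G A a c) (nb : ¬ TE G A b c) (ta : TE G B a c)
    (tb : TE G B b c) (nd : ¬ TD G B a b c) : False := by
  have half : ∀ {a b : V}, Cfg G a b c A B → ¬ G.Adj a c → ∀ f, Col G A f → f c ≠ f a →
      f c ≠ f b → ¬ TE G A a c → TE G B a c → ¬ TD G B a b c → 
      ∃ S, S ⊆ A ∧ b ∉ S ∧ (∀ x ∈ S, f x ≠ f b) ∧ CP G S a c 3 := by
    intro a b C nac f hf hca hcb ne ⟨g, hg, gca⟩ nd
    obtain ⟨n, S, n1, S1, S2, S3, h1⟩ := F2 C.bA C.aA C.cA C.hab hf hca hcb ne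
    obtain ⟨m, T, m1, T1, T2, -, h2⟩ := F1 C.aB C.bB C.cB C.hab hg gca nd
    have h5 := C.glue1 nac h1 h2 S1 T1 S2 T2 (n1.add_even m1)
    have l1 := h1.two_le C.hac nac
    have l2 := h2.two_le C.hac nac
    have hn : n = 3 := by
      obtain ⟨k, rfl⟩ := m1
      obtain ⟨j, rfl⟩ := n1
      omega
    subst hn
    exact ⟨S, S1, S2, S3, h1⟩
  obtain ⟨f, hf, hca, hcb⟩ := td
  obtain ⟨S, S1, S2, S3, h1⟩ := half C nac f hf hca hcb na ta nd
  obtain ⟨T, T1, T2, T3, h2⟩ := half C.swapab nbc f hf hcb hca nb tb (fun h => nd h.swap)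
  obtain ⟨p, p1, q, q1, e1, e2, e3, hP, hsub, hnb⟩ := C.len3' nac nbc h1 S2
  obtain ⟨p', p1', q', q1', e1', e2', e3', hP', hsub', hnb'⟩ := C.swapab.len3' nbc nac h2 T2
  have hqq : q ≠ q' := by
    rintro rfl
    have z1 := S3 q q1
    have z2 := T3 q q1'
    have z3 := hf q (S1 q1) c C.cA e3
    have z4 := hf a C.aA b C.bA C.hab
    omega
  have hqc : q ≠ c := e3.ne
  have hpc : p ≠ c := by rintro rfl; exact nac e1
  have hpc' : p' ≠ c := by rintro rfl; exact nbc e1'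
  have hpq' : p ≠ q' := by rintro rfl; exact C.no3 _ _ _ e2 e3 e3'.symm
  have hpq : p' ≠ q := by rintro rfl; exact C.no3 _ _ _ e2' e3' e3.symm
  have hab := C.hab
  have := C.glue2' nac hP hP' (by
    rintro x (rfl | rfl | rfl | rfl)
    · tauto
    · rintro y (rfl | rfl | rfl | rfl) hxy
      · tauto
      · exfalso
        rcases hxy with rfl | hxy
        · exact C.no3 _ _ _ e1 e1'.symm hab.symm
        · refine C.no4 a x y b ?_ ?_ e1 hxy e1'.symm hab.symm
          · rintro rfl; exact T2 p1'
          · rintro rfl; exact S2 p1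
      · exfalso
        rcases hxy with rfl | hxy
        · exact hpq' rfl
        · exact C.no4 x q c y hpc hqq e2 e3 e3'.symm hxy.symm
      · tauto
    · rintro y (rfl | rfl | rfl | rfl) hxy
      · tauto
      · exfalso
        rcases hxy with rfl | hxy
        · exact hpq rfl
        · exact C.no4 y q' c x hpc' hqq.symm e2' e3' e3.symm hxy
      · exfalso
        rcases hxy with rfl | hxy
        · exact hqq rfl
        · exact C.no3 _ _ _ hxy e3' e3.symm
      · tauto
    · tauto) (fun h => S2 (hsub h)) (fun h => T2 (hsub' h)) hnb hnb' (by decide)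
  omega

/-- Auxiliary for case III: an odd path next to an even-type alternative is impossible. -/
lemma Cfg.mixed (C : Cfg G a b c A B) (nbc : ¬ G.Adj b c) {S T U : Set V} {n m k : ℕ}
    (h1 : CP G S b c n) (h2 : CP G T b c m) (h3 : CP G U b c k) (o1 : Odd n) (e2 : Even m)
    (e3 : Even k) (S1 : S ⊆ A) (T1 : T ⊆ B) (U1 : U ⊆ B) (aS : a ∉ S) (aT : a ∉ T) (aU : a ∉ U)
    (hmk : ¬ (m = 2 ∧ k = 2)) : False := by
  have g1 := C.swapab.glue1 nbc h1 h2 S1 T1 aS aT (o1.add_even e2)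
  have g2 := C.swapab.glue1 nbc h1 h3 S1 U1 aS aU (o1.add_even e3)
  have l1 := h1.two_le C.hbc nbc
  have l2 := h2.two_le C.hbc nbc
  obtain ⟨i, rfl⟩ := e2
  omega

lemma Cfg.O3 (C : Cfg G a b c A B) (nbc : ¬ G.Adj b c) {S T : Set V} {n m : ℕ}
    (h1 : CP G S b c n) (h2 : CP G T b c m) (o1 : Odd n) (e2 : Even m)
    (S1 : S ⊆ A) (T1 : T ⊆ B) (aS : a ∉ S) (aT : a ∉ T) : n = 3 := by
  have g1 := C.swapab.glue1 nbc h1 h2 S1 T1 aS aT (o1.add_even e2)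
  have l1 := h1.two_le C.hbc nbc
  have l2 := h2.two_le C.hbc nbc
  obtain ⟨i, rfl⟩ := e2
  omega

/-- Case III. -/
lemma Cfg.caseIII (C : Cfg G a b c A B) (nac : ¬ G.Adj a c) (nbc : ¬ G.Adj b c)
    (ta : TE G A a c) (nd : ¬ TD G A a b c) (nb : ¬ TE G A b c)
    (tb : TE G B b c) (nd' : ¬ TD G B a b c) (na : ¬ TE G B a c) : False := by
  obtain ⟨n, S, n1, S1, S2, h1, h3⟩ :=
    F3i C.aA C.bA C.cA C.hab C.hac C.hbc (C.no4' a c C.hac) ta nd nb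
  obtain ⟨m, T, m1, T1, T2, h2, h4⟩ :=
    F3i C.bB C.aB C.cB C.hab.symm C.hbc C.hac (C.no4' b c C.hbc) tb (fun h => nd' h.swap) na
  have D := C.swapab.swapAB
  rcases h3 with ⟨k, U, k1, U1, U2, h3⟩ | ⟨k, U, k1, U1, U2, U3, h3, hnk⟩ <;>
  rcases h4 with ⟨l, W, l1, W1, W2, h4⟩ | ⟨l, W, l1, W1, W2, W3, h4, hml⟩
  · have hk := C.O3 nbc h3 h2 k1 m1 U1 T1 U2 T2
    have hl := D.O3 nac h4 h1 l1 n1 W1 S1 W2 S2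
    subst hk hl
    obtain ⟨p, p1, q, q1, -, -, -, hP, hsub, hnb⟩ := C.swapab.len3' nbc nac h3 U2
    obtain ⟨p', p1', q', q1', -, -, -, hP', hsub', hnb'⟩ := C.len3' nac nbc h4 W2
    have := C.swapAB.glue2 nac hP' hP (hsub'.trans W1) (hsub.trans U1) (fun h => W2 (hsub' h))
      (fun h => U2 (hsub h)) hnb' hnb (by decide)
    omega
  · exact C.mixed nbc h3 h2 h4 k1 m1 l1 U1 T1 W1 U2 T2 W2 hml
  · exact D.mixed nac h4 h1 h3 l1 n1 k1 W1 S1 U1 W2 S2 U2 hnk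
  · have g := C.glue2 nac h3 h4 U1 W1 U2 W2 U3 W3 (k1.add_odd l1.add_one)
    have lk := h3.two_le C.hac nac
    have ll := h4.two_le C.hbc nbc
    have hk : k = 2 := by omega
    have hl : l = 2 := by omega
    subst hk hl
    rcases reroute h1 C.hab C.hac nac S2 (fun x h h' => C.no3 _ _ _ h h'.symm C.hab.symm) with
      ⟨S', S1', S3', h1'⟩ | ⟨S', i, S1', S2', S3', h1'⟩
    · have := C.glue2 nac h1' h4 (S1'.trans S1) W1 (fun h => S2 (S1' h)) W2 S3' W3
        (n1.add_odd l1.add_one)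
      exact hnk ⟨by omega, rfl⟩
    rcases reroute h2 C.hab.symm C.hbc nbc T2 (fun x h h' => C.no3 _ _ _ h h'.symm C.hab) with
      ⟨T', T1', T3', h2'⟩ | ⟨T', j, T1', T2', T3', h2'⟩
    · have := C.glue2 nac h3 h2' U1 (T1'.trans T1) U2 (fun h => T2 (T1' h)) U3 T3'
        (k1.add_odd m1.add_one)
      exact hml ⟨by omega, rfl⟩
    have S4 : S' ⊆ A := S1'.trans (Set.insert_subset C.bA S1)
    have T4 : T' ⊆ B := T1'.trans (Set.insert_subset C.aB T1)
    have ei : Even i := by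
      rw [← Nat.not_odd_iff_even]
      intro oi
      exact C.mixed nbc h1' h2 h4 oi m1 l1 S4 T1 W1 S2' T2 W2 hml
    have ej : Even j := by
      rw [← Nat.not_odd_iff_even]
      intro oj
      exact D.mixed nac h2' h1 h3 oj n1 k1 T4 S1 U1 T2' S2 U2 hnk
    have g := C.swapAB.glue2 nac h2' h1' T4 S4 T2' S2' T3' S3' (ej.add_odd ei.add_one)
    have li := h1'.two_le C.hbc nbc
    have lj := h2'.two_le C.hac nac
    have hi : i = 2 := by omega
    subst hi
    obtain ⟨z, z1, z2, z3⟩ := h1'.len2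
    obtain ⟨y, y1, y2, y3⟩ := h4.len2
    refine C.no4' b c C.hbc z y ?_ z2 z3 y2 y3
    rintro rfl
    rcases C.int z (S4 z1) (W1 y1) with rfl | rfl | rfl
    · exact S2' z1
    · exact G.irrefl z2
    · exact G.irrefl z3

lemma Cfg.false (C : Cfg G a b c A B) : False := by
  by_cases hbc : G.Adj b c
  · exact C.caseA hbc.symm
  by_cases hac : G.Adj a c
  · exact C.swapab.caseA hac.symm
  have s : ∀ {A : Set V}, TD G A b a c ↔ TD G A a b c := ⟨TD.swap, TD.swap⟩
  have i1 := C.caseI hac hbc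
  have i2 := C.swapAB.caseI hac hbc
  have i3 := C.swapab.caseI hbc hac
  have i4 := C.swapab.swapAB.caseI hbc hac
  have j1 := C.caseII hac hbc
  have j2 := C.swapAB.caseII hac hbc
  have k1 := C.caseIII hac hbc
  have k2 := C.swapAB.caseIII hac hbc
  rw [s, s] at i3 i4
  have e1 := C.exA
  have e2 := C.exB
  have d1 := C.nEa
  have d2 := C.nEb
  have d3 := C.nD
  clear s C
  generalize TE G A a c = p1 at *
  generalize TE G A b c = p2 at *
  generalize TD G A a b c = p3 at *
  generalize TE G B a c = q1 at *
  generalize TE G B b c = q2 at *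
  generalize TD G B a b c = q3 at *
  by_cases p1 <;> by_cases p2 <;> by_cases p3 <;> by_cases q1 <;> by_cases q2 <;> by_cases q3 <;>
    simp_all

end PG

/-- for `G ∈ 𝒢₀`, every 3-cutset of `G` is a stable set. -/
theorem stmt_7 {V : Type*} [Fintype V] (G : SimpleGraph V) (hG : G.MemG0) :
    ∀ X : Set V, X.ncard = 3 → G.IsCutset X → ∀ a ∈ X, ∀ b ∈ X, ¬ G.Adj a b := by
  classical
  intro X hX hcut a ha b hb hab
  obtain ⟨⟨hgirth, hhole⟩, hchi, hcrit⟩ := hG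
  have hgirth' : ∀ (u : V) (w : G.Walk u u), w.IsCycle → 5 ≤ w.length := by
    intro u w hw
    have := G.egirth_le_length hw
    rw [hgirth] at this
    exact_mod_cast this
  have hnc : ¬ G.Colorable 3 := by
    intro h
    have := h.chromaticNumber_le
    rw [hchi] at this
    exact absurd this (by decide)
  have hnc' : ∀ f : V → Fin 3, ¬ (∀ x y, G.Adj x y → f x ≠ f y) := fun f hf =>
    hnc ⟨Coloring.mk f (fun {x y} h => hf x y h)⟩
  -- the third vertex
  obtain ⟨c, hac, hbc, hXe⟩ : ∃ c, a ≠ c ∧ b ≠ c ∧ X = {a, b, c} := by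
    have hsub : ({a, b} : Set V) ⊆ X := by
      rintro x (rfl | rfl) <;> assumption
    have h2 : ({a, b} : Set V).ncard = 2 := Set.ncard_pair hab.ne
    have h3 : (X \ {a, b}).ncard = 1 := by
      rw [Set.ncard_sdiff hsub (Set.toFinite _)]; omega
    obtain ⟨c, hc⟩ := Set.ncard_eq_one.1 h3
    have hc' : c ∈ X \ {a, b} := by rw [hc]; rfl
    refine ⟨c, ?_, ?_, ?_⟩
    · rintro rfl; simp at hc'
    · rintro rfl; simp at hc'
    · ext x
      have := Set.ext_iff.1 hc x
      simp at this
      have hcX := hc'.1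
      simp only [Set.mem_insert_iff, Set.mem_singleton_iff]
      constructor
      · intro hx; tauto
      · rintro (rfl | rfl | rfl) <;> assumption
  have hcX : c ∈ X := by rw [hXe]; simp
  -- two vertices in different components
  obtain ⟨u, hu, v, hv, huv⟩ : ∃ u, ∃ _ : u ∉ X, ∃ v, ∃ _ : v ∉ X, ¬ PG.RC G Xᶜ u v := by
    by_contra hcon
    push Not at hcon
    apply hcut
    by_cases hne : ∃ u, u ∉ X
    · obtain ⟨u, hu⟩ := hne
      haveI : Nonempty (Xᶜ : Set V) := ⟨⟨u, hu⟩⟩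
      refine ⟨?_⟩
      rintro ⟨x, hx⟩ ⟨y, hy⟩
      obtain ⟨P, hP⟩ := hcon x hx y hy
      exact ⟨P.induce _ hP⟩
    · push Not at hne
      exfalso
      apply hnc
      have h1 : X = Set.univ := Set.eq_univ_of_forall hne
      rw [h1, Set.ncard_univ, Nat.card_eq_fintype_card] at hX
      rw [← hX]
      exact G.colorable_of_fintype
  -- the two sides
  have hcol : ∀ A : Set V, A ≠ Set.univ → ∃ f, PG.Col G A f := by
    intro A hA
    have hne : (⊤ : G.Subgraph).induce A ≠ ⊤ := by
      intro h
      apply hA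
      have := congrArg Subgraph.verts h
      simpa using this
    obtain ⟨φ⟩ := hcrit _ hne
    refine ⟨fun x => if h : x ∈ A then φ ⟨x, h⟩ else 0, fun x hx y hy hxy => ?_⟩
    simp only [hx, hy, dif_pos]
    exact φ.valid (by simp [hx, hy, hxy])
  set A : Set V := X ∪ {x | PG.RC G Xᶜ u x} with hA
  set B : Set V := X ∪ {x | ¬ PG.RC G Xᶜ u x} with hB
  have hinter : ∀ x, x ∈ A → x ∈ B → x ∈ X := by
    rintro x (h | h) (h' | h')
    · exact h
    · exact h
    · exact h'
    · exact absurd h h'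
  have hsep : ∀ x ∈ A, ∀ y ∈ B, G.Adj x y → x ∈ B ∨ y ∈ A := by
    rintro x (hx | hx) y (hy | hy) hxy
    · exact Or.inl (Or.inl hx)
    · exact Or.inl (Or.inl hx)
    · exact Or.inr (Or.inl hy)
    · by_cases hyX : y ∈ X
      · exact Or.inr (Or.inl hyX)
      · exact absurd (PG.RC.step hx hxy hyX) hy
  have hcov : ∀ x, x ∉ A → x ∈ B := by
    intro x hx
    by_cases h : PG.RC G Xᶜ u x
    · exact absurd (Or.inr h) hx
    · exact Or.inr h
  obtain ⟨fA, hfA⟩ := hcol A (fun h => by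
    have : v ∈ A := h ▸ Set.mem_univ v
    rcases this with h | h
    · exact hv h
    · exact huv h)
  obtain ⟨fB, hfB⟩ := hcol B (fun h => by
    have : u ∈ B := h ▸ Set.mem_univ u
    rcases this with h | h
    · exact hu h
    · exact h (PG.RC.refl hu))
  have ex : ∀ A f, PG.Col G A f → PG.TE G A a c ∨ PG.TE G A b c ∨ PG.TD G A a b c := by
    intro A f hf
    by_cases h1 : f c = f a
    · exact Or.inl ⟨f, hf, h1⟩
    by_cases h2 : f c = f b
    · exact Or.inr (Or.inl ⟨f, hf, h2⟩)
    · exact Or.inr (Or.inr ⟨f, hf, h1, h2⟩)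
  have comb : ∀ f g : V → Fin 3, PG.Col G A f → PG.Col G B g →
      (∀ σ : Equiv.Perm (Fin 3), σ (g a) = f a → σ (g b) = f b → σ (g c) = f c) → False := by
    intro f g hf hg hσ
    have hp : ∀ x y z w : Fin 3, x ≠ y → z ≠ w → ∃ σ : Equiv.Perm (Fin 3), σ x = z ∧ σ y = w := by
      decide
    obtain ⟨σ, s1, s2⟩ := hp _ _ _ _ (hg a (Or.inl ha) b (Or.inl hb) hab)
      (hf a (Or.inl ha) b (Or.inl hb) hab)
    have s3 := hσ σ s1 s2
    have sX : ∀ x ∈ X, σ (g x) = f x := by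
      rw [hXe]
      rintro x (rfl | rfl | rfl) <;> assumption
    have aux : ∀ x y, x ∈ A → y ∉ A → G.Adj x y → f x ≠ σ (g y) := by
      intro x y hx hy hxy
      have hyB := hcov y hy
      have hxB : x ∈ B := (hsep x hx y hyB hxy).resolve_right hy
      rw [← sX x (hinter x hx hxB)]
      simpa using hg x hxB y hyB hxy
    refine hnc' (fun x => if x ∈ A then f x else σ (g x)) ?_
    intro x y hxy
    by_cases h1 : x ∈ A <;> by_cases h2 : y ∈ A <;> simp only [h1, h2, if_true, if_false]
    · exact hf x h1 y h2 hxy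
    · exact aux x y h1 h2 hxy
    · exact (aux y x h2 h1 hxy.symm).symm
    · simpa using hg x (hcov x h1) y (hcov y h2) hxy
  refine PG.Cfg.false (G := G) (a := a) (b := b) (c := c) (A := A) (B := B) ?_
  refine
    { no3 := ?_, no4 := ?_, hole := ?_, hab := hab, hac := hac, hbc := hbc, int := ?_,
      aA := Or.inl ha, bA := Or.inl hb, cA := Or.inl hcX,
      aB := Or.inl ha, bB := Or.inl hb, cB := Or.inl hcX,
      sep := hsep, nEa := ?_, nEb := ?_, nD := ?_, exA := ex A fA hfA, exB := ex B fB hfB }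
  · intro x y z h1 h2 h3
    have := hgirth' x (Walk.cons h1 (Walk.cons h2 (Walk.cons h3 Walk.nil))) (by
      have := h1.ne; have := h2.ne; have := h3.ne
      rw [Walk.cons_isCycle_iff]
      simp [Walk.cons_isPath_iff]
      grind)
    simp at this
  · intro x y z w hxz hyw h1 h2 h3 h4
    have := hgirth' x (Walk.cons h1 (Walk.cons h2 (Walk.cons h3 (Walk.cons h4 Walk.nil)))) (by
      have := h1.ne; have := h2.ne; have := h3.ne; have := h4.ne
      rw [Walk.cons_isCycle_iff]
      simp [Walk.cons_isPath_iff]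
      grind)
    simp at this
  · intro n hn hh
    have h7 : ¬ (7 ≤ n) := fun h => hhole n hn h hh
    obtain ⟨-, w, W, hW, -, rfl⟩ := hh
    have := hgirth' _ W hW
    obtain ⟨k, hk⟩ := hn
    omega
  · intro x h1 h2
    have := hinter x h1 h2
    rw [hXe] at this
    simpa using this
  · rintro ⟨f, hf, h1⟩ ⟨g, hg, h2⟩
    exact comb f g hf hg (fun σ s1 s2 => by rw [h2, s1, h1])
  · rintro ⟨f, hf, h1⟩ ⟨g, hg, h2⟩
    exact comb f g hf hg (fun σ s1 s2 => by rw [h2, s2, h1])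
  · rintro ⟨f, hf, h1, h1'⟩ ⟨g, hg, h2, h2'⟩
    refine comb f g hf hg (fun σ s1 s2 => ?_)
    have n1 : σ (g c) ≠ f a := by rw [← s1]; simpa using h2
    have n2 : σ (g c) ≠ f b := by rw [← s2]; simpa using h2'
    have n3 := hf a (Or.inl ha) b (Or.inl hb) hab
    omega
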